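/- Let x₁,…,x_i be independent standard Gaussian random vectors in ℝ^d with 1 ≤ i ≤ d. Then there exist constants c, C > 0 depending only on d and i such that for every integer ℓ ≥ 0, c·e^{-(d-i+1)ℓ} ≤ Prob(e^{-(ℓ+1)} ≤ ‖x₁ ∧ ⋯ ∧ x_i‖ ≤ e^{-ℓ}) ≤ C·e^{-(d-i+1)ℓ}. -/

import Mathlib

open MeasureTheory ProbabilityTheory

/-- The standard Gaussian measure on `ℝ^d` (i.i.d. `N(0,1)` coordinates). -/
noncomputable def stdGaussian (d : ℕ) : Measure (Fin d → ℝ) :=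
  Measure.pi fun _ => gaussianReal 0 1

/-- The norm of the wedge product `x₁ ∧ ⋯ ∧ x_i` in `⋀^i ℝ^d`, computed as the square
root of the Gram determinant. -/
noncomputable def wedgeNorm {d : ℕ} {i : ℕ} (x : Fin i → (Fin d → ℝ)) : ℝ :=
  Real.sqrt (Matrix.det (Matrix.of fun a b : Fin i => ∑ j, x a j * x b j))

open scoped ENNReal

instance isProbabilityMeasure_stdGaussian (d : ℕ) : IsProbabilityMeasure (_root_.stdGaussian d) := by
  unfold _root_.stdGaussian; infer_instance

/-- Orthogonal projection maps the standard Gaussian to the standard Gaussian. -/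
theorem map_orthogonalProjectionOnto_stdGaussian {E : Type*} [NormedAddCommGroup E]
    [InnerProductSpace ℝ E] [FiniteDimensional ℝ E] [MeasurableSpace E] [BorelSpace E]
    (V : Submodule ℝ E) :
    (ProbabilityTheory.stdGaussian E).map V.orthogonalProjectionOnto
      = ProbabilityTheory.stdGaussian V := by
  apply Measure.ext_of_charFun
  ext t
  rw [charFun_stdGaussian, charFun_apply,
    integral_map (by fun_prop) (by fun_prop)]
  have h := charFun_stdGaussian (t : E)
  rw [charFun_apply] at h
  simpa only [Submodule.inner_orthogonalProjectionOnto_eq_of_mem_right, Submodule.coe_norm] using h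

/-- The norm of a standard Gaussian vector has a law depending only on the dimension. -/
theorem map_norm_stdGaussian {E : Type*} [NormedAddCommGroup E]
    [InnerProductSpace ℝ E] [FiniteDimensional ℝ E] [MeasurableSpace E] [BorelSpace E] :
    (ProbabilityTheory.stdGaussian E).map norm =
      (ProbabilityTheory.stdGaussian (EuclideanSpace ℝ (Fin (Module.finrank ℝ E)))).map norm := by
  rw [← stdGaussian_map (stdOrthonormalBasis ℝ E).repr,
    Measure.map_map (by fun_prop) (by fun_prop)]
  congr 1
  ext y
  simp

/-- The Gram determinant is multiplied by the squared distance to the span when a vector is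
added. -/
theorem Matrix.det_gram_cons {E : Type*} [NormedAddCommGroup E]
    [InnerProductSpace ℝ E] [FiniteDimensional ℝ E] {n : ℕ} (y : E) (x : Fin n → E) :
    (Matrix.gram ℝ (Fin.cons y x : Fin (n + 1) → E)).det =
      (Matrix.gram ℝ x).det *
        ‖(Submodule.span ℝ (Set.range x))ᗮ.orthogonalProjectionOnto y‖ ^ 2 := by
  set V := Submodule.span ℝ (Set.range x)
  set q := Vᗮ.orthogonalProjectionOnto y
  obtain ⟨c, hc⟩ := (Submodule.mem_span_range_iff_exists_fun ℝ).1
    (V.orthogonalProjectionOnto y).2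
  have hy : y = ∑ a, c a • x a + q := by
    rw [hc]
    exact (Submodule.starProjection_add_starProjection_orthogonal (K := V) y).symm
  have hqx (a : Fin n) : inner ℝ (q : E) (x a) = 0 := by
    rw [real_inner_comm]
    exact Submodule.inner_right_of_mem_orthogonal (K := V) (Submodule.subset_span ⟨a, rfl⟩) q.2
  have hqy : inner ℝ (q : E) y = ‖q‖ ^ 2 := by
    conv_lhs => rw [hy]
    rw [inner_add_right, inner_sum]
    simp [inner_smul_right, hqx]
  set M := Matrix.gram ℝ (Fin.cons y x : Fin (n + 1) → E) with hM
  have h := Matrix.det_updateRow_sum M 0 (Fin.cons 1 (fun a => - c a))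
  have hq : (q : E) = y - ∑ a, c a • x a := by rw [eq_sub_iff_add_eq, add_comm]; exact hy.symm
  have hrow : ∑ k, (Fin.cons 1 (fun a => - c a) : Fin (n + 1) → ℝ) k • M k =
      Fin.cons (‖q‖ ^ 2) 0 := by
    have h1 : ∑ k, (Fin.cons 1 (fun a => - c a) : Fin (n + 1) → ℝ) k • M k =
        fun b => inner ℝ (q : E) ((Fin.cons y x : Fin (n + 1) → E) b) := by
      ext b
      rw [hq, inner_sub_left, sum_inner]
      simp [Fin.sum_univ_succ, hM, Matrix.gram_apply, inner_smul_left, sub_eq_add_neg]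
    rw [h1]
    ext b
    refine Fin.cases ?_ (fun b => ?_) b <;> simp [hqy, hqx]
  rw [hrow] at h
  simp only [Fin.cons_zero, one_smul] at h
  rw [← h, Matrix.det_succ_row_zero, Fin.sum_univ_succ]
  simp only [Matrix.updateRow_self, Fin.cons_zero, Fin.cons_succ, Pi.zero_apply, mul_zero,
    zero_mul, Finset.sum_const_zero, add_zero, Fin.val_zero, pow_zero, one_mul]
  rw [mul_comm]
  congr 2

theorem wedgeNorm_eq_sqrt_det_gram {d i : ℕ} (x : Fin i → Fin d → ℝ) :
    wedgeNorm x = √(Matrix.gram ℝ fun a => WithLp.toLp 2 (x a)).det := by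
  simp [wedgeNorm, Matrix.gram, PiLp.inner_apply, mul_comm]

/-- The span of the vectors `x a`, inside Euclidean space. -/
noncomputable def euclideanSpan {d i : ℕ} (x : Fin i → Fin d → ℝ) :
    Submodule ℝ (EuclideanSpace ℝ (Fin d)) :=
  Submodule.span ℝ (Set.range fun a => WithLp.toLp 2 (x a))

theorem wedgeNorm_cons {d i : ℕ} (y : Fin d → ℝ) (x : Fin i → Fin d → ℝ) :
    wedgeNorm (Fin.cons y x : Fin (i + 1) → Fin d → ℝ) =
      wedgeNorm x * ‖(euclideanSpan x)ᗮ.orthogonalProjectionOnto (WithLp.toLp 2 y)‖ := by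
  rw [wedgeNorm_eq_sqrt_det_gram, wedgeNorm_eq_sqrt_det_gram]
  have h : (fun a => WithLp.toLp 2 ((Fin.cons y x : Fin (i + 1) → Fin d → ℝ) a)) =
      (Fin.cons (WithLp.toLp 2 y) (fun a => WithLp.toLp 2 (x a)) :
        Fin (i + 1) → EuclideanSpace ℝ (Fin d)) := by
    ext a : 1
    refine Fin.cases ?_ (fun b => ?_) a <;> simp
  rw [h, Matrix.det_gram_cons, Real.sqrt_mul (Matrix.posSemidef_gram ℝ _).det_nonneg,
    Real.sqrt_sq (norm_nonneg _)]
  rfl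

theorem wedgeNorm_nonneg {d i : ℕ} (x : Fin i → Fin d → ℝ) : 0 ≤ wedgeNorm x :=
  Real.sqrt_nonneg _

theorem measurable_wedgeNorm {d i : ℕ} :
    Measurable (wedgeNorm : (Fin i → Fin d → ℝ) → ℝ) := by
  apply Continuous.measurable
  unfold wedgeNorm
  refine Real.continuous_sqrt.comp (Continuous.matrix_det ?_)
  fun_prop

theorem measurable_inv_wedgeNorm_pow {d i : ℕ} (k : ℕ) :
    Measurable fun x : Fin i → Fin d → ℝ => (ENNReal.ofReal (wedgeNorm x))⁻¹ ^ k :=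
  (measurable_wedgeNorm.ennreal_ofReal.inv).pow_const k

theorem le_finrank_euclideanSpan_orthogonal {d i : ℕ} (x : Fin i → Fin d → ℝ) :
    d - i ≤ Module.finrank ℝ (euclideanSpan x)ᗮ := by
  have h := Submodule.finrank_add_finrank_orthogonal (euclideanSpan x)
  have h2 := finrank_range_le_card (R := ℝ) (fun a => WithLp.toLp 2 (x a))
  rw [finrank_euclideanSpace_fin] at h
  simp only [Set.finrank, Fintype.card_fin] at h2
  change Module.finrank ℝ (euclideanSpan x) ≤ i at h2
  omega

theorem finrank_euclideanSpan_orthogonal {d i : ℕ} {x : Fin i → Fin d → ℝ}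
    (hx : 0 < wedgeNorm x) : Module.finrank ℝ (euclideanSpan x)ᗮ = d - i := by
  have h := Submodule.finrank_add_finrank_orthogonal (euclideanSpan x)
  rw [finrank_euclideanSpace_fin] at h
  rw [wedgeNorm_eq_sqrt_det_gram, Real.sqrt_pos] at hx
  have h2 := finrank_span_eq_card (Matrix.linearIndependent_of_det_gram_ne_zero hx.ne')
  rw [Fintype.card_fin] at h2
  change Module.finrank ℝ (euclideanSpan x) = i at h2
  omega

/-- Conditionally on `x₁,…,x_i`, the norm of the next wedge product is `‖x₁ ∧ ⋯ ∧ x_i‖` times the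
norm of a standard Gaussian vector in the orthogonal complement of the span. -/
theorem lintegral_wedgeNorm_succ {d i : ℕ} {g : ℝ → ℝ≥0∞} (hg : Measurable g) :
    ∫⁻ x, g (wedgeNorm x) ∂(Measure.pi fun _ : Fin (i + 1) => _root_.stdGaussian d) =
      ∫⁻ x, ∫⁻ z, g (wedgeNorm x * ‖z‖) ∂(ProbabilityTheory.stdGaussian
          (EuclideanSpace ℝ (Fin (Module.finrank ℝ (euclideanSpan x)ᗮ))))
        ∂(Measure.pi fun _ : Fin i => _root_.stdGaussian d) := by
  have hmp := measurePreserving_piFinSuccAbove (fun _ : Fin (i + 1) => _root_.stdGaussian d) 0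
  have hm : Measurable fun x : Fin (i + 1) → Fin d → ℝ => g (wedgeNorm x) :=
    hg.comp measurable_wedgeNorm
  rw [← (hmp.symm _).lintegral_comp_emb (MeasurableEquiv.measurableEmbedding _),
    lintegral_prod_symm']
  · congr 1 with x
    have hc (y : Fin d → ℝ) :
        (MeasurableEquiv.piFinSuccAbove (fun _ => Fin d → ℝ) 0).symm (y, x) =
          (Fin.cons y x : Fin (i + 1) → Fin d → ℝ) := by
      simp [MeasurableEquiv.piFinSuccAbove, Fin.insertNthEquiv]
    simp only [hc, wedgeNorm_cons]
    have hn : Measurable fun r : ℝ => g (wedgeNorm x * r) := hg.comp (by fun_prop)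
    set W := (euclideanSpan x)ᗮ
    have e1 : ∫⁻ y, g (wedgeNorm x * ‖W.orthogonalProjectionOnto (WithLp.toLp 2 y)‖)
          ∂_root_.stdGaussian d =
        ∫⁻ y, g (wedgeNorm x * ‖y‖) ∂(ProbabilityTheory.stdGaussian W) := by
      have hn' : Measurable fun y : W => g (wedgeNorm x * ‖y‖) := hn.comp measurable_norm
      rw [← map_orthogonalProjectionOnto_stdGaussian, ← map_pi_eq_stdGaussian,
        Measure.map_map (by fun_prop) (by fun_prop), lintegral_map hn' (by fun_prop)]
      rfl
    rw [e1, ← lintegral_map hn measurable_norm, map_norm_stdGaussian,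
      lintegral_map hn measurable_norm]
  · exact hm.comp (MeasurableEquiv.measurable _)

theorem stdGaussian_forall_coord_mem (m : ℕ) (s : Set ℝ) (hs : MeasurableSet s) :
    ProbabilityTheory.stdGaussian (EuclideanSpace ℝ (Fin m)) {z | ∀ a, z a ∈ s} =
      gaussianReal 0 1 s ^ m := by
  have hms : MeasurableSet {z : EuclideanSpace ℝ (Fin m) | ∀ a, z a ∈ s} := by
    rw [Set.ofPred_forall]
    exact MeasurableSet.iInter fun a => hs.preimage (by fun_prop)
  rw [← map_pi_eq_stdGaussian, Measure.map_apply (by fun_prop) hms]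
  have h : WithLp.toLp 2 ⁻¹' {z : EuclideanSpace ℝ (Fin m) | ∀ a, z a ∈ s} =
      Set.univ.pi fun _ => s := by
    ext; simp
  rw [h, Measure.pi_pi]
  simp

/-- Small ball estimate for the standard Gaussian measure. -/
theorem stdGaussian_norm_le (m : ℕ) (s : ℝ) :
    ProbabilityTheory.stdGaussian (EuclideanSpace ℝ (Fin m)) {z | ‖z‖ ≤ s} ≤
      ENNReal.ofReal s ^ m := by
  calc _ ≤ ProbabilityTheory.stdGaussian (EuclideanSpace ℝ (Fin m))
        {z | ∀ a, z a ∈ Set.Icc (-s) s} :=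
        measure_mono fun z hz a => abs_le.1 ((PiLp.norm_apply_le z a).trans hz)
    _ = gaussianReal 0 1 (Set.Icc (-s) s) ^ m := stdGaussian_forall_coord_mem _ _ measurableSet_Icc
    _ ≤ _ := by
      gcongr
      rw [gaussianReal_apply 0 one_ne_zero]
      have hb (x : ℝ) : gaussianPDF 0 1 x ≤ ENNReal.ofReal (1 / 2) := by
        unfold gaussianPDF gaussianPDFReal
        apply ENNReal.ofReal_le_ofReal
        have h1 : Real.exp (-(x - 0) ^ 2 / (2 * ((1 : NNReal) : ℝ))) ≤ 1 := by
          rw [Real.exp_le_one_iff]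
          simp only [NNReal.coe_one]
          nlinarith [sq_nonneg (x - 0)]
        have h2 : (√(2 * Real.pi * ((1 : NNReal) : ℝ)))⁻¹ ≤ 1 / 2 := by
          rw [inv_le_comm₀ (by simp [Real.pi_pos]) (by norm_num)]
          apply Real.le_sqrt_of_sq_le
          norm_num
          linarith [Real.pi_gt_three]
        calc _ ≤ (√(2 * Real.pi * ((1 : NNReal) : ℝ)))⁻¹ * 1 := by gcongr
          _ ≤ _ := by simpa using h2
      calc _ ≤ ∫⁻ _ in Set.Icc (-s) s, ENNReal.ofReal (1 / 2) := lintegral_mono fun x => hb x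
        _ = ENNReal.ofReal (1 / 2) * ENNReal.ofReal (s - -s) := by
          rw [setLIntegral_const, Real.volume_Icc]
        _ = ENNReal.ofReal s := by
          rw [← ENNReal.ofReal_mul (by norm_num)]
          congr 1
          ring

/-- Lower bound for the standard Gaussian measure of an annulus of bounded radius. -/
theorem exists_le_stdGaussian_annulus {m : ℕ} (hm : 1 ≤ m) (S : ℝ) :
    ∃ c : ℝ, 0 < c ∧ ∀ s : ℝ, 0 < s → s ≤ S → ENNReal.ofReal (c * s ^ m) ≤
      ProbabilityTheory.stdGaussian (EuclideanSpace ℝ (Fin m))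
        {z | s * Real.exp (-1) ≤ ‖z‖ ∧ ‖z‖ ≤ s} := by
  have hm0 : (0 : ℝ) < √m := Real.sqrt_pos.2 (by exact_mod_cast hm)
  have hm1 : (1 : ℝ) ≤ √m := Real.one_le_sqrt.2 (by exact_mod_cast hm)
  have hp : 0 < gaussianPDFReal 0 1 S := gaussianPDFReal_pos 0 1 S one_ne_zero
  refine ⟨(gaussianPDFReal 0 1 S * (2 * √m)⁻¹) ^ m, by positivity, fun s hs hsS => ?_⟩
  have hsub : {z : EuclideanSpace ℝ (Fin m) | ∀ a, z a ∈ Set.Icc (s / (2 * √m)) (s / √m)} ⊆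
      {z | s * Real.exp (-1) ≤ ‖z‖ ∧ ‖z‖ ≤ s} := by
    intro z hz
    have hn : ‖z‖ ^ 2 = ∑ a, z a ^ 2 := EuclideanSpace.real_norm_sq_eq z
    have hlo : (s / 2) ^ 2 ≤ ‖z‖ ^ 2 := by
      rw [hn]
      calc (s / 2) ^ 2 = ∑ _a : Fin m, (s / (2 * √m)) ^ 2 := by
            simp [div_pow, mul_pow]; field_simp
        _ ≤ _ := by
            gcongr with a
            exact (hz a).1
    have hhi : ‖z‖ ^ 2 ≤ s ^ 2 := by
      rw [hn]
      calc _ ≤ ∑ _a : Fin m, (s / √m) ^ 2 := by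
            gcongr with a
            · exact le_trans (by positivity) (hz a).1
            · exact (hz a).2
        _ = s ^ 2 := by simp [div_pow]; field_simp
    refine ⟨?_, (pow_le_pow_iff_left₀ (norm_nonneg _) hs.le two_ne_zero).1 hhi⟩
    have h2 := (pow_le_pow_iff_left₀ (by positivity) (norm_nonneg _) two_ne_zero).1 hlo
    have he : Real.exp (-1) ≤ 1 / 2 := by
      rw [Real.exp_neg, one_div]
      gcongr
      linarith [Real.add_one_le_exp 1]
    nlinarith
  refine le_trans ?_ (measure_mono hsub)
  rw [stdGaussian_forall_coord_mem _ _ measurableSet_Icc, ← mul_pow, ENNReal.ofReal_pow (by positivity)]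
  gcongr
  rw [gaussianReal_apply 0 one_ne_zero]
  calc _ = ∫⁻ _ in Set.Icc (s / (2 * √m)) (s / √m), gaussianPDF 0 1 S := by
        rw [setLIntegral_const, Real.volume_Icc, gaussianPDF, ← ENNReal.ofReal_mul hp.le]
        congr 1
        field_simp
        ring
    _ ≤ _ := by
        refine setLIntegral_mono (by fun_prop) fun x hx => ENNReal.ofReal_le_ofReal ?_
        have hx0 : 0 ≤ x := le_trans (by positivity) hx.1
        have hxS : x ≤ S := hx.2.trans ((div_le_self hs.le hm1).trans hsS)
        unfold gaussianPDFReal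
        gcongr

/-- Negative moments of the norm of a Gaussian vector, of order less than the dimension, are
bounded uniformly in the dimension. -/
theorem exists_lintegral_inv_norm_pow_le (k : ℕ) :
    ∃ C : ℝ≥0∞, C ≠ ∞ ∧ ∀ m, k < m →
      ∫⁻ z, (ENNReal.ofReal ‖z‖)⁻¹ ^ k
        ∂(ProbabilityTheory.stdGaussian (EuclideanSpace ℝ (Fin m))) ≤ C := by
  refine ⟨1 + ∑' n : ℕ, 2 ^ k * (2⁻¹ : ℝ≥0∞) ^ n, ?_, fun m hkm => ?_⟩
  · rw [ENNReal.tsum_mul_left, ENNReal.tsum_geometric, ENNReal.one_sub_inv_two, inv_inv]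
    finiteness
  set P := ProbabilityTheory.stdGaussian (EuclideanSpace ℝ (Fin m))
  have hmeas (s : ℝ) : MeasurableSet {z : EuclideanSpace ℝ (Fin m) | ‖z‖ ≤ s} :=
    measurableSet_le measurable_norm measurable_const
  have hne : ∀ᵐ z ∂P, ‖z‖ ≠ 0 := by
    have h := stdGaussian_norm_le m 0
    rw [ENNReal.ofReal_zero, zero_pow (by omega)] at h
    refine measure_mono_null (fun z hz => ?_) (le_antisymm h zero_le)
    simp only [ne_eq, Set.mem_compl_iff, Set.mem_ofPred_eq, not_not] at hz
    exact hz.le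
  calc _ ≤ ∫⁻ z, 1 + ∑' n : ℕ, {z : EuclideanSpace ℝ (Fin m) | ‖z‖ ≤ (2⁻¹ : ℝ) ^ n}.indicator
          (fun _ => ((2 : ℝ≥0∞) ^ (n + 1)) ^ k) z ∂P := by
        refine lintegral_mono_ae (hne.mono fun z hz => ?_)
        have hz0 : 0 < ‖z‖ := lt_of_le_of_ne (norm_nonneg _) (Ne.symm hz)
        rcases le_or_gt ‖z‖ 1 with h1 | h1
        · obtain ⟨n, hn1, hn2⟩ := exists_nat_pow_near_of_lt_one hz0 h1
            (y := (2⁻¹ : ℝ)) (by norm_num) (by norm_num)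
          refine le_trans ?_ (le_add_left (ENNReal.le_tsum n))
          rw [Set.indicator_of_mem (by exact hn2)]
          gcongr
          rw [ENNReal.inv_le_iff_inv_le, ENNReal.inv_pow]
          calc (2⁻¹ : ℝ≥0∞) ^ (n + 1) = ENNReal.ofReal ((2⁻¹ : ℝ) ^ (n + 1)) := by
                rw [ENNReal.ofReal_pow (by norm_num), ENNReal.ofReal_inv_of_pos (by norm_num)]
                simp
            _ ≤ _ := ENNReal.ofReal_le_ofReal hn1.le
        · refine le_add_right (pow_le_one₀ zero_le ?_)
          rw [ENNReal.inv_le_one]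
          exact ENNReal.one_le_ofReal.2 h1.le
    _ = 1 + ∑' n : ℕ, ((2 : ℝ≥0∞) ^ (n + 1)) ^ k * P {z | ‖z‖ ≤ (2⁻¹ : ℝ) ^ n} := by
        rw [lintegral_add_left measurable_const, lintegral_tsum]
        · simp_rw [lintegral_indicator_const (hmeas _)]
          simp
        · exact fun n => (measurable_const.indicator (hmeas _)).aemeasurable
    _ ≤ _ := by
        refine add_le_add_right (ENNReal.tsum_le_tsum fun n => ?_) 1
        calc _ ≤ ((2 : ℝ≥0∞) ^ (n + 1)) ^ k * ((2⁻¹ : ℝ≥0∞) ^ n) ^ (k + 1) := by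
              refine mul_le_mul_right ?_ _
              refine (stdGaussian_norm_le m _).trans ?_
              rw [ENNReal.ofReal_pow (by norm_num), ENNReal.ofReal_inv_of_pos (by norm_num)]
              simp only [ENNReal.ofReal_ofNat]
              exact pow_le_pow_of_le_one zero_le (pow_le_one₀ zero_le (by simp)) hkm
          _ = 2 ^ k * 2⁻¹ ^ n * ((2 * 2⁻¹) ^ (n * k)) := by
              rw [mul_pow]; ring
          _ = _ := by rw [ENNReal.mul_inv_cancel (by simp) (by simp)]; simp

theorem lintegral_inv_wedgeNorm_pow_ne_top {d k i : ℕ} (h : k + i ≤ d) :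
    ∫⁻ x, (ENNReal.ofReal (wedgeNorm x))⁻¹ ^ k
      ∂(Measure.pi fun _ : Fin i => _root_.stdGaussian d) ≠ ∞ := by
  induction i with
  | zero => simp [wedgeNorm]
  | succ i ih =>
    obtain ⟨C, hC, hCk⟩ := exists_lintegral_inv_norm_pow_le k
    have hg : Measurable fun r : ℝ => (ENNReal.ofReal r)⁻¹ ^ k := by fun_prop
    rw [lintegral_wedgeNorm_succ (d := d) (i := i) hg]
    refine ne_top_of_le_ne_top (ENNReal.mul_ne_top (ih (by omega)) hC) ?_
    rw [← lintegral_mul_const _ (measurable_inv_wedgeNorm_pow k)]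
    refine lintegral_mono fun x => ?_
    have hx : k < Module.finrank ℝ (euclideanSpan x)ᗮ :=
      lt_of_lt_of_le (by omega) (le_finrank_euclideanSpan_orthogonal x)
    simp only [ENNReal.ofReal_mul (wedgeNorm_nonneg x)]
    simp_rw [ENNReal.mul_inv (Or.inr ENNReal.ofReal_ne_top) (Or.inl ENNReal.ofReal_ne_top),
      mul_pow]
    rw [lintegral_const_mul _ (by fun_prop)]
    gcongr
    exact hCk _ hx

theorem exists_wedgeNorm_mem_Icc_pos {d i : ℕ} (h : i < d) :
    ∃ a b : ℝ, 0 < a ∧ 0 < b ∧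
      (Measure.pi fun _ : Fin i => _root_.stdGaussian d) {x | wedgeNorm x ∈ Set.Icc a b} ≠ 0 := by
  by_contra! hcon
  set μ := Measure.pi fun _ : Fin i => _root_.stdGaussian d
  have hU : μ (⋃ n : ℕ, {x | wedgeNorm x ∈ Set.Icc (1 / ((n : ℝ) + 1)) (n + 1)}) = 0 :=
    measure_iUnion_null fun n => hcon _ _ (by positivity) (by positivity)
  have hpos : ∀ᵐ x ∂μ, 0 < wedgeNorm x := by
    filter_upwards [ae_lt_top (measurable_inv_wedgeNorm_pow 1)
      (lintegral_inv_wedgeNorm_pow_ne_top (by omega))] with x hx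
    rw [pow_one, ENNReal.inv_lt_top, ENNReal.ofReal_pos] at hx
    exact hx
  have hfalse : ∀ᵐ x ∂μ, False := by
    filter_upwards [hpos, measure_eq_zero_iff_ae_notMem.1 hU] with x hx hxU
    apply hxU
    obtain ⟨n, hn⟩ := exists_nat_ge (max (wedgeNorm x) (wedgeNorm x)⁻¹)
    refine Set.mem_iUnion.2 ⟨n, ?_, ?_⟩
    · rw [one_div, inv_le_comm₀ (by positivity) hx]
      linarith [(le_max_right _ _).trans hn]
    · linarith [(le_max_left _ _).trans hn]
  rw [ae_iff] at hfalse
  simp [μ] at hfalse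

/-- For independent standard Gaussians `x₁,…,x_i` in `ℝ^d` (`1 ≤ i ≤ d`), there are
constants `c, C > 0` depending only on `d, i` such that for every `ℓ : ℕ`,
`c·e^{-(d-i+1)ℓ} ≤ P(e^{-(ℓ+1)} ≤ ‖x₁∧⋯∧x_i‖ ≤ e^{-ℓ}) ≤ C·e^{-(d-i+1)ℓ}`. -/
theorem prob_wedgeNorm_annulus
    (d i : ℕ) (hi : 1 ≤ i) (hid : i ≤ d) :
    ∃ c C : ℝ, 0 < c ∧ 0 < C ∧
      ∀ ℓ : ℕ,
        ENNReal.ofReal (c * Real.exp (-(((d : ℝ) - i + 1) * ℓ)))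
          ≤ (Measure.pi fun _ : Fin i => stdGaussian d)
              {x | Real.exp (-(ℓ + 1 : ℝ)) ≤ wedgeNorm x ∧ wedgeNorm x ≤ Real.exp (-(ℓ : ℝ))} ∧
        (Measure.pi fun _ : Fin i => stdGaussian d)
              {x | Real.exp (-(ℓ + 1 : ℝ)) ≤ wedgeNorm x ∧ wedgeNorm x ≤ Real.exp (-(ℓ : ℝ))}
          ≤ ENNReal.ofReal (C * Real.exp (-(((d : ℝ) - i + 1) * ℓ))) := by
  obtain ⟨i, rfl⟩ : ∃ j, i = j + 1 := ⟨i - 1, by omega⟩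
  set k := d - i with hk
  have hkd : (d : ℝ) - (i + 1 : ℕ) + 1 = k := by
    rw [hk, Nat.cast_sub (by omega)]
    push_cast
    ring
  have hexp (ℓ : ℕ) : Real.exp (-((k : ℝ) * ℓ)) = Real.exp (-(ℓ : ℝ)) ^ k := by
    rw [← Real.exp_nat_mul]
    ring_nf
  simp only [hkd, hexp]
  set μ := Measure.pi fun _ : Fin i => _root_.stdGaussian d
  have key (ℓ : ℕ) : (Measure.pi fun _ : Fin (i + 1) => _root_.stdGaussian d)
      {x | Real.exp (-(ℓ + 1 : ℝ)) ≤ wedgeNorm x ∧ wedgeNorm x ≤ Real.exp (-(ℓ : ℝ))} =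
      ∫⁻ x, ProbabilityTheory.stdGaussian
          (EuclideanSpace ℝ (Fin (Module.finrank ℝ (euclideanSpan x)ᗮ)))
        {z | wedgeNorm x * ‖z‖ ∈ Set.Icc (Real.exp (-(ℓ + 1 : ℝ))) (Real.exp (-(ℓ : ℝ)))} ∂μ := by
    have h := lintegral_wedgeNorm_succ (d := d) (i := i)
      (g := (Set.Icc (Real.exp (-(ℓ + 1 : ℝ))) (Real.exp (-(ℓ : ℝ)))).indicator 1)
      (measurable_one.indicator measurableSet_Icc)
    convert h using 1
    · exact (lintegral_indicator_one (measurable_wedgeNorm measurableSet_Icc)).symm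
    · congr 1 with x
      refine (lintegral_indicator_one (measurableSet_Icc.preimage ?_)).symm
      fun_prop
  simp only [key]
  obtain ⟨a, b, ha, hb, hab⟩ := exists_wedgeNorm_mem_Icc_pos (d := d) (i := i) (by omega)
  obtain ⟨c, hc, hcs⟩ := exists_le_stdGaussian_annulus (m := k) (by omega) a⁻¹
  have hI := lintegral_inv_wedgeNorm_pow_ne_top (d := d) (k := k) (i := i) (by omega)
  set A := {x : Fin i → Fin d → ℝ | wedgeNorm x ∈ Set.Icc a b}
  have hA : 0 < (μ A).toReal := ENNReal.toReal_pos hab (measure_ne_top _ _)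
  set I := ∫⁻ x, (ENNReal.ofReal (wedgeNorm x))⁻¹ ^ k ∂μ
  refine ⟨c * b⁻¹ ^ k * (μ A).toReal, I.toReal + 1, by positivity, by positivity,
    fun ℓ => ⟨?_, ?_⟩⟩
  · calc _ = ENNReal.ofReal (c * (Real.exp (-(ℓ : ℝ)) / b) ^ k) * μ A := by
          nth_rw 2 [← ENNReal.ofReal_toReal (measure_ne_top μ A)]
          rw [← ENNReal.ofReal_mul (by positivity)]
          congr 1
          rw [div_eq_mul_inv, mul_pow]
          ring
      _ = ∫⁻ _ in A, ENNReal.ofReal (c * (Real.exp (-(ℓ : ℝ)) / b) ^ k) ∂μ := by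
          rw [setLIntegral_const]
      _ ≤ ∫⁻ x in A, ProbabilityTheory.stdGaussian
          (EuclideanSpace ℝ (Fin (Module.finrank ℝ (euclideanSpan x)ᗮ)))
        {z | wedgeNorm x * ‖z‖ ∈ Set.Icc (Real.exp (-(ℓ + 1 : ℝ))) (Real.exp (-(ℓ : ℝ)))} ∂μ := by
          refine setLIntegral_mono' (measurable_wedgeNorm measurableSet_Icc) fun x hx => ?_
          have hx0 : 0 < wedgeNorm x := ha.trans_le hx.1
          rw [finrank_euclideanSpan_orthogonal hx0]
          calc _ ≤ ENNReal.ofReal (c * (Real.exp (-(ℓ : ℝ)) / wedgeNorm x) ^ k) := by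
                gcongr
                exact hx.2
            _ ≤ _ := hcs _ (by positivity) (by
                rw [inv_eq_one_div]
                gcongr
                · simp
                · exact hx.1)
            _ = _ := by
                congr 1
                ext z
                have he : Real.exp (-(ℓ + 1 : ℝ)) = Real.exp (-(ℓ : ℝ)) * Real.exp (-1) := by
                  rw [← Real.exp_add]
                  ring_nf
                simp only [Set.mem_ofPred_eq, Set.mem_Icc, he, le_div_iff₀' hx0,
                  div_mul_eq_mul_div, div_le_iff₀' hx0]
                rfl
      _ ≤ _ := setLIntegral_le_lintegral _ _
  · calc _ ≤ ∫⁻ x, (ENNReal.ofReal (wedgeNorm x))⁻¹ ^ k *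
            ENNReal.ofReal (Real.exp (-(ℓ : ℝ)) ^ k) ∂μ := by
          refine lintegral_mono fun x => ?_
          rcases (wedgeNorm_nonneg x).eq_or_lt with hx0 | hx0
          · have hem : ¬ Real.exp (-(ℓ + 1 : ℝ)) ≤ 0 := not_le.2 (Real.exp_pos _)
            simp only [← hx0, zero_mul, Set.mem_Icc, hem, false_and]
            exact (measure_empty (μ := ProbabilityTheory.stdGaussian _)).trans_le zero_le
          rw [finrank_euclideanSpan_orthogonal hx0]
          calc _ ≤ ProbabilityTheory.stdGaussian (EuclideanSpace ℝ (Fin (d - i)))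
                  {z | ‖z‖ ≤ Real.exp (-(ℓ : ℝ)) / wedgeNorm x} :=
                measure_mono fun z hz => (le_div_iff₀' hx0).2 hz.2
            _ ≤ _ := stdGaussian_norm_le _ _
            _ = _ := by
                rw [ENNReal.ofReal_pow (by positivity), ← mul_pow,
                  ← ENNReal.ofReal_inv_of_pos hx0, ← ENNReal.ofReal_mul (by positivity),
                  div_eq_inv_mul]
      _ = I * ENNReal.ofReal (Real.exp (-(ℓ : ℝ)) ^ k) :=
          lintegral_mul_const _ (measurable_inv_wedgeNorm_pow k)
      _ ≤ _ := by
          rw [ENNReal.ofReal_mul (by positivity)]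
          gcongr
          rw [ENNReal.ofReal_add (by positivity) zero_le_one, ENNReal.ofReal_toReal hI]
          exact le_self_add
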